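/- Let n ≥ 2 be even and set α = n/2. The polynomial p(x) = 1 − 2x − x² + 2x^{α+1} − 2x^{α+2} + 2x^{2α+2} has a unique real root r in the open interval (0,1) (which is its root of smallest magnitude), and the growth rate of BS(1,n) equals its reciprocal: lim_{N→∞} |S_n(N)|^{1/N} = 1/r. -/

import Mathlib

open Filter Topology

abbrev Letter : Type := Fin 2 × Bool

def bsRels (n : ℕ) : Set (FreeGroup (Fin 2)) :=
  {FreeGroup.of 1 * FreeGroup.of 0 * (FreeGroup.of 1)⁻¹ * (FreeGroup.of 0 ^ n)⁻¹}

abbrev BS (n : ℕ) : Type := PresentedGroup (bsRels n)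

def bsA (n : ℕ) : BS n := PresentedGroup.of 0

def bsT (n : ℕ) : BS n := PresentedGroup.of 1

def evalLetter (n : ℕ) (l : Letter) : BS n :=
  cond l.2 (if l.1 = 0 then bsA n else bsT n) (if l.1 = 0 then (bsA n)⁻¹ else (bsT n)⁻¹)

def evalWord (n : ℕ) (wd : List Letter) : BS n := (wd.map (evalLetter n)).prod

noncomputable def wordLength (n : ℕ) (g : BS n) : ℕ :=
  sInf {N : ℕ | ∃ wd : List Letter, evalWord n wd = g ∧ wd.length = N}

def bsSphere (n N : ℕ) : Set (BS n) := {g : BS n | wordLength n g = N}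


/-! ### Digit cost functions -/

noncomputable def nxt (n : ℕ) (f : ℤ → ℕ) (u : ℤ) : ℕ :=
  sInf (Set.range fun z : ℤ => (u - n * z).natAbs + f z)

noncomputable def cst (n : ℕ) : ℕ → ℤ → ℕ
  | 0 => Int.natAbs
  | L + 1 => nxt n (cst n L)

theorem nxt_le (n : ℕ) (f : ℤ → ℕ) (u z : ℤ) : nxt n f u ≤ (u - n * z).natAbs + f z :=
  Nat.sInf_le ⟨z, rfl⟩

theorem nxt_ex (n : ℕ) (f : ℤ → ℕ) (u : ℤ) :
    ∃ z : ℤ, nxt n f u = (u - n * z).natAbs + f z := by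
  have h := Nat.sInf_mem (Set.range_nonempty fun z : ℤ => (u - n * z).natAbs + f z)
  obtain ⟨z, hz⟩ := h
  exact ⟨z, hz.symm⟩

theorem cst_add (n : ℕ) : ∀ (L j : ℕ), j ≤ L → ∀ (u s : ℤ), s.natAbs ≤ 1 →
    cst n L (u + s * (n : ℤ) ^ j) ≤ cst n L u + 1 := by
  intro L
  induction L with
  | zero =>
    intro j hj u s hs
    obtain rfl : j = 0 := by omega
    simp only [cst, pow_zero]; omega
  | succ L ih =>
    intro j hj u s hs
    obtain ⟨z, hz⟩ := nxt_ex n (cst n L) u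
    simp only [cst]
    rw [hz]
    rcases j with _ | j
    · refine (nxt_le n (cst n L) _ z).trans ?_
      simp only [pow_zero]; omega
    · refine (nxt_le n (cst n L) _ (z + s * (n : ℤ) ^ j)).trans ?_
      have h1 := ih j (by omega) z s hs
      have h2 : u + s * (n : ℤ) ^ (j + 1) - n * (z + s * (n : ℤ) ^ j) = u - n * z := by ring
      rw [h2]; omega

theorem cst_succ_le (n : ℕ) : ∀ (L : ℕ) (u : ℤ), cst n (L + 1) u ≤ cst n L u := by
  intro L
  induction L with
  | zero =>
    intro u
    have := nxt_le n Int.natAbs u 0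
    simpa [cst] using this
  | succ L ih =>
    intro u
    obtain ⟨z, hz⟩ := nxt_ex n (cst n L) u
    have h1 := nxt_le n (cst n (L + 1)) u z
    have h2 := ih z
    change nxt n (cst n (L + 1)) u ≤ nxt n (cst n L) u
    omega

theorem cst_mul_le (n L : ℕ) (u : ℤ) : cst n (L + 1) (n * u) ≤ cst n L u := by
  have := nxt_le n (cst n L) (n * u) u
  simpa [cst] using this

def Lip (f : ℤ → ℕ) : Prop := ∀ u, f (u + 1) ≤ f u + 1 ∧ f u ≤ f (u + 1) + 1

theorem cst_lip (n L : ℕ) : Lip (cst n L) := by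
  intro u
  have h1 := cst_add n L 0 (Nat.zero_le _) u 1 (by simp)
  have h2 := cst_add n L 0 (Nat.zero_le _) (u + 1) (-1) (by simp)
  simp only [pow_zero, mul_one] at h1 h2
  rw [show u + 1 + -1 = u by ring] at h2
  exact ⟨h1, h2⟩

theorem Lip.le {f : ℤ → ℕ} (hf : Lip f) (u : ℤ) (k : ℕ) :
    f (u + k) ≤ f u + k ∧ f u ≤ f (u + k) + k := by
  induction k with
  | zero => simp
  | succ k ih =>
    have := hf (u + k)
    push_cast
    rw [← add_assoc]
    omega

theorem Lip.le' {f : ℤ → ℕ} (hf : Lip f) (u v : ℤ) : f u ≤ f v + (u - v).natAbs := by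
  rcases le_total u v with h | h
  · have := (hf.le u (v - u).natAbs).2
    rw [show u + ((v - u).natAbs : ℤ) = v by omega] at this
    omega
  · have := (hf.le v (u - v).natAbs).1
    rw [show v + ((u - v).natAbs : ℤ) = u by omega] at this
    omega

theorem nxt_small {f : ℤ → ℕ} (hf : Lip f) (β : ℕ) (z e : ℤ) (he : e.natAbs ≤ β) :
    nxt (2 * β + 2) f ((2 * β + 2 : ℕ) * z + e) = e.natAbs + f z := by
  apply le_antisymm
  · refine (nxt_le _ _ _ z).trans (le_of_eq ?_)
    congr 2; ring
  · obtain ⟨z', hz⟩ := nxt_ex (2 * β + 2) f ((2 * β + 2 : ℕ) * z + e)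
    rw [hz]
    have h1 := hf.le' z z'
    have h2 : ((2 * β + 2 : ℕ) : ℤ) * z + e - ((2 * β + 2 : ℕ) : ℤ) * z'
      = ((2 * β + 2 : ℕ) : ℤ) * (z - z') + e := by ring
    rw [h2]
    generalize z - z' = k at *
    have h3 : (2 * β + 1) * k.natAbs + k.natAbs ≤
        (((2 * β + 2 : ℕ) : ℤ) * k + e).natAbs + e.natAbs := by
      have : (2 * β + 1) * k.natAbs + k.natAbs = (((2 * β + 2 : ℕ) : ℤ) * k).natAbs := by
        rw [Int.natAbs_mul, Int.natAbs_natCast]; ring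
      omega
    rcases Nat.eq_zero_or_pos k.natAbs with hk | hk
    · obtain rfl : k = 0 := by omega
      simp at *; omega
    · have : (2 * β + 1) ≤ (2 * β + 1) * k.natAbs := Nat.le_mul_of_pos_right _ hk
      omega

theorem nxt_mid {f : ℤ → ℕ} (hf : Lip f) (β : ℕ) (z : ℤ) :
    nxt (2 * β + 2) f ((2 * β + 2 : ℕ) * z + (β + 1)) = β + 1 + min (f z) (f (z + 1)) := by
  apply le_antisymm
  · have h1 := nxt_le (2 * β + 2) f ((2 * β + 2 : ℕ) * z + (β + 1)) z
    have h2 := nxt_le (2 * β + 2) f ((2 * β + 2 : ℕ) * z + (β + 1)) (z + 1)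
    rw [show ((2 * β + 2 : ℕ) : ℤ) * z + (β + 1) - (2 * β + 2 : ℕ) * z = ((β + 1 : ℕ) : ℤ) by
      push_cast; ring, Int.natAbs_natCast] at h1
    rw [show ((2 * β + 2 : ℕ) : ℤ) * z + (β + 1) - (2 * β + 2 : ℕ) * (z + 1)
      = -((β + 1 : ℕ) : ℤ) by push_cast; ring, Int.natAbs_neg, Int.natAbs_natCast] at h2
    omega
  · obtain ⟨z', hz⟩ := nxt_ex (2 * β + 2) f ((2 * β + 2 : ℕ) * z + (β + 1))
    rw [hz]
    have h1 := hf.le' z z'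
    have h1' := hf.le' (z + 1) z'
    rcases le_or_gt z' z with h | h
    · obtain ⟨k, hk⟩ := Int.eq_ofNat_of_zero_le (show 0 ≤ z - z' by omega)
      have h2 : ((2 * β + 2 : ℕ) : ℤ) * z + (β + 1) - ((2 * β + 2 : ℕ) : ℤ) * z'
        = (((2 * β + 1) * k + k + (β + 1) : ℕ) : ℤ) := by
        rw [show z = z' + k by omega]; push_cast; ring
      rw [h2, Int.natAbs_natCast]
      rw [hk, Int.natAbs_natCast] at h1
      have := Nat.zero_le ((2 * β + 1) * k)
      omega
    · obtain ⟨k, hk⟩ := Int.eq_ofNat_of_zero_le (show 0 ≤ z' - (z + 1) by omega)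
      have h2 : ((2 * β + 2 : ℕ) : ℤ) * z + (β + 1) - ((2 * β + 2 : ℕ) : ℤ) * z'
        = -(((2 * β + 1) * k + k + (β + 1) : ℕ) : ℤ) := by
        rw [show z' = z + 1 + k by omega]; push_cast; ring
      rw [h2, Int.natAbs_neg, Int.natAbs_natCast]
      rw [show z + 1 - z' = -(k : ℤ) by omega, Int.natAbs_neg, Int.natAbs_natCast] at h1'
      have := Nat.zero_le ((2 * β + 1) * k)
      omega

/-! ### The transfer identity -/

noncomputable def wt (wm w0 wp : ℝ) (f : ℤ → ℕ) (u : ℤ) : ℝ :=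
  if f (u + 1) < f u then wm else if f (u + 1) = f u then w0 else wp

theorem transfer {f : ℤ → ℕ} (hf : Lip f) (β : ℕ) (wm w0 wp x G : ℝ)
    (hG : G = ∑ i ∈ Finset.range β, x ^ i)
    (e1 : wm * (x ^ 2 * G + x ^ (β + 1)) + w0 * x ^ (β + 1) + wp * (x * G) = wm)
    (e2 : wm * (x ^ 2 * G + x ^ (β + 2)) + wp * (x * G + x ^ (β + 1)) = w0)
    (e3 : wm * (x ^ 2 * G) + w0 * x ^ (β + 2) + wp * (x * G + x ^ (β + 1)) = wp) (z : ℤ) :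
    ∑ i ∈ Finset.range (2 * β + 2),
      wt wm w0 wp (nxt (2 * β + 2) f) ((2 * β + 2 : ℕ) * z + i - β) *
        x ^ (1 + nxt (2 * β + 2) f ((2 * β + 2 : ℕ) * z + i - β))
    = wt wm w0 wp f z * x ^ f z := by
  set F := nxt (2 * β + 2) f with hF
  have V1 : ∀ e : ℤ, e.natAbs ≤ β → F ((2 * β + 2 : ℕ) * z + e) = e.natAbs + f z :=
    fun e he => nxt_small hf β z e he
  have V2 := nxt_mid hf β z
  rw [← hF] at V2
  have V3 : F ((2 * β + 2 : ℕ) * z + (β + 1) + 1) = β + f (z + 1) := by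
    have := nxt_small hf β (z + 1) (-β) (by omega)
    rw [Int.natAbs_neg, Int.natAbs_natCast] at this
    rw [← this, hF]; congr 1; push_cast; ring
  rw [Finset.sum_range_succ, Finset.sum_range_succ, two_mul β, Finset.sum_range_add,
    ← Finset.sum_range_reflect]
  rw [← two_mul β]
  have S1 : ∑ j ∈ Finset.range β, wt wm w0 wp F ((2 * β + 2 : ℕ) * z + (β - 1 - j : ℕ) - β) *
      x ^ (1 + F ((2 * β + 2 : ℕ) * z + (β - 1 - j : ℕ) - β)) = wm * x ^ 2 * G * x ^ f z := by
    rw [hG, Finset.mul_sum, Finset.sum_mul]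
    refine Finset.sum_congr rfl fun j hj => ?_
    rw [Finset.mem_range] at hj
    rw [show ((2 * β + 2 : ℕ) : ℤ) * z + (β - 1 - j : ℕ) - β
      = (2 * β + 2 : ℕ) * z + (-(j + 1) : ℤ) by omega]
    have a1 := V1 (-(j + 1) : ℤ) (by omega)
    have a2 := V1 (-(j + 1) + 1 : ℤ) (by omega)
    rw [wt, if_pos, a1, show (-((j : ℤ) + 1)).natAbs = j + 1 by omega]
    · ring
    · rw [add_assoc, a1, a2]; omega
  have S2 : ∑ j ∈ Finset.range β, wt wm w0 wp F ((2 * β + 2 : ℕ) * z + (β + j : ℕ) - β) *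
      x ^ (1 + F ((2 * β + 2 : ℕ) * z + (β + j : ℕ) - β)) = wp * x * G * x ^ f z := by
    rw [hG, Finset.mul_sum, Finset.sum_mul]
    refine Finset.sum_congr rfl fun j hj => ?_
    rw [Finset.mem_range] at hj
    rw [show ((2 * β + 2 : ℕ) : ℤ) * z + (β + j : ℕ) - β
      = (2 * β + 2 : ℕ) * z + (j : ℤ) by omega]
    have a1 := V1 (j : ℤ) (by omega)
    have a2 := V1 (j + 1 : ℤ) (by omega)
    rw [wt, if_neg, if_neg, a1, show ((j : ℤ)).natAbs = j by omega]
    · ring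
    · rw [add_assoc, a1, a2]; omega
    · rw [add_assoc, a1, a2]; omega
  rw [S1, S2]
  rw [show ((2 * β + 2 : ℕ) : ℤ) * z + (2 * β : ℕ) - β = (2 * β + 2 : ℕ) * z + (β : ℤ) by
    push_cast; ring,
    show ((2 * β + 2 : ℕ) : ℤ) * z + (2 * β + 1 : ℕ) - β = (2 * β + 2 : ℕ) * z + (β + 1 : ℤ) by
    push_cast; ring]
  have a1 := V1 β (by omega)
  rw [Int.natAbs_natCast] at a1
  unfold wt
  rw [V3, add_assoc _ (β : ℤ) 1, a1, V2]
  obtain ⟨l1, l2⟩ := hf z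
  clear V1 V2 V3 S1 S2 a1 hG
  rcases lt_trichotomy (f (z + 1)) (f z) with h | h | h
  · obtain ⟨k, hk⟩ : ∃ k, f (z + 1) = k := ⟨_, rfl⟩
    have hk' : f z = k + 1 := by omega
    rw [hk, hk', min_eq_right (by omega)]
    split_ifs <;> first | omega | skip
    linear_combination x ^ (k + 1) * e1
  · rw [h, min_self]
    generalize f z = k
    split_ifs <;> first | omega | skip
    linear_combination x ^ k * e2
  · have hk' : f (z + 1) = f z + 1 := by omega
    rw [hk', min_eq_left (by omega)]
    generalize f z = k
    split_ifs <;> first | omega | skip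
    linear_combination x ^ k * e3

def W0 (x : ℝ) (β : ℕ) : ℝ := (1 - x ^ (β + 1)) * (1 + x ^ (β + 2))
def Wm (x : ℝ) (β : ℕ) : ℝ := 1 - x ^ (β + 1) * x ^ (β + 2)
def Wp (x : ℝ) (β : ℕ) : ℝ :=
  (1 - x ^ (β + 1)) * (1 + x ^ (β + 2)) - x ^ (β + 1) * x ^ (β + 2) + (x ^ (β + 2)) ^ 2

theorem W_pos {x : ℝ} (h0 : 0 < x) (h1 : x < 1) (β : ℕ) :
    0 < W0 x β ∧ 0 < Wm x β ∧ 0 < Wp x β := by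
  have hq0 : 0 < x ^ (β + 1) := by positivity
  have hq1 : x ^ (β + 1) ≤ x := by
    simpa using pow_le_pow_of_le_one h0.le h1.le (show 1 ≤ β + 1 by omega)
  unfold W0 Wm Wp
  rw [show x ^ (β + 2) = x * x ^ (β + 1) by ring]
  generalize x ^ (β + 1) = q at *
  have hy : x * q < 1 := by nlinarith
  have hy0 : 0 < x * q := by positivity
  have hqy : q * (x * q) < 1 := by nlinarith
  refine ⟨by apply mul_pos <;> linarith, by linarith, ?_⟩
  have h2 : q * (x * q) * (1 - x) ≤ 1 - x := by nlinarith
  nlinarith [mul_nonneg (sub_nonneg.2 hq1) hy0.le, mul_pos (sub_pos.2 h1) hy0]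

theorem W_eqs {x : ℝ} (h1 : x < 1) (β : ℕ) (G : ℝ)
    (hG : G = ∑ i ∈ Finset.range β, x ^ i)
    (hp : 1 - 2 * x - x ^ 2 + 2 * x ^ (β + 2) - 2 * x ^ (β + 3) + 2 * x ^ (2 * β + 4) = 0) :
    Wm x β * (x ^ 2 * G + x ^ (β + 1)) + W0 x β * x ^ (β + 1) + Wp x β * (x * G) = Wm x β ∧
    Wm x β * (x ^ 2 * G + x ^ (β + 2)) + Wp x β * (x * G + x ^ (β + 1)) = W0 x β ∧
    Wm x β * (x ^ 2 * G) + W0 x β * x ^ (β + 2) + Wp x β * (x * G + x ^ (β + 1)) = Wp x β := by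
  have hB : x * G * (1 - x) = x - x ^ (β + 1) := by
    have := mul_neg_geom_sum x β
    rw [← hG] at this
    linear_combination x * this
  have hx : (1 - x) ≠ 0 := by linarith
  unfold W0 Wm Wp
  rw [show x ^ (β + 2) = x * x ^ (β + 1) by ring, show x ^ (β + 3) = x ^ 2 * x ^ (β + 1) by ring,
    show x ^ (2 * β + 4) = x ^ 2 * (x ^ (β + 1)) ^ 2 by ring] at hp
  rw [show x ^ (β + 2) = x * x ^ (β + 1) by ring]
  generalize x ^ (β + 1) = q at *
  refine ⟨?_, ?_, ?_⟩ <;> apply mul_left_cancel₀ hx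
  · linear_combination (x * (1 - q * (x * q)) + ((1 - q) * (1 + x * q) - q * (x * q)
      + (x * q) ^ 2)) * hB - (1 - q) * hp
  · linear_combination (x * (1 - q * (x * q)) + ((1 - q) * (1 + x * q) - q * (x * q)
      + (x * q) ^ 2)) * hB - (1 - q) * hp
  · linear_combination (x * (1 - q * (x * q)) + ((1 - q) * (1 + x * q) - q * (x * q)
      + (x * q) ^ 2)) * hB - (1 - q) * hp

/-! ### Partition functions -/

open scoped ENNReal

noncomputable def Zsum (x : ℝ) (β L : ℕ) : ℝ≥0∞ :=
  ∑' u : ℤ, ENNReal.ofReal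
    (wt (Wm x β) (W0 x β) (Wp x β) (cst (2 * β + 2) L) u * x ^ (L + cst (2 * β + 2) L u))

theorem wt_cases (wm w0 wp : ℝ) (f : ℤ → ℕ) (u : ℤ) (P : ℝ → Prop) (h1 : P wm) (h2 : P w0)
    (h3 : P wp) : P (wt wm w0 wp f u) := by
  unfold wt; split_ifs <;> assumption

theorem Zsum_succ {x : ℝ} (h0 : 0 < x) (h1 : x < 1) (β L : ℕ)
    (hp : 1 - 2 * x - x ^ 2 + 2 * x ^ (β + 2) - 2 * x ^ (β + 3) + 2 * x ^ (2 * β + 4) = 0) :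
    Zsum x β (L + 1) = Zsum x β L := by
  obtain ⟨p1, p2, p3⟩ := W_pos h0 h1 β
  obtain ⟨e1, e2, e3⟩ := W_eqs h1 β _ rfl hp
  unfold Zsum
  rw [← (Equiv.subRight (β : ℤ)).tsum_eq, ← (Int.divModEquiv (2 * β + 2)).symm.tsum_eq,
    ENNReal.tsum_prod']
  refine tsum_congr fun z => ?_
  rw [tsum_fintype]
  have ht := transfer (cst_lip (2 * β + 2) L) β _ _ _ x _ rfl e1 e2 e3 z
  have hs : wt (Wm x β) (W0 x β) (Wp x β) (cst (2 * β + 2) L) z * x ^ (L + cst (2 * β + 2) L z)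
    = x ^ L * (wt (Wm x β) (W0 x β) (Wp x β) (cst (2 * β + 2) L) z *
      x ^ (cst (2 * β + 2) L z)) := by ring
  rw [hs, ← ht, Finset.mul_sum, ENNReal.ofReal_sum_of_nonneg, Finset.sum_range]
  · refine Finset.sum_congr rfl fun i _ => ?_
    have : (Equiv.subRight (β : ℤ)) ((Int.divModEquiv (2 * β + 2)).symm (z, i))
        = ((2 * β + 2 : ℕ) : ℤ) * z + (i : ℕ) - β := by
      simp [Int.divModEquiv]; ring
    rw [this]
    congr 1
    change _ * x ^ (L + 1 + nxt (2 * β + 2) (cst (2 * β + 2) L) _) = _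
    rw [add_assoc, pow_add x L]
    change wt _ _ _ (nxt (2 * β + 2) (cst (2 * β + 2) L)) _ * _ = _
    ring
  · intro i _
    have := wt_cases (Wm x β) (W0 x β) (Wp x β) (nxt (2 * β + 2) (cst (2 * β + 2) L))
      (((2 * β + 2 : ℕ) : ℤ) * z + (i : ℕ) - β) (fun t => 0 < t) p2 p1 p3
    positivity

theorem Zsum_zero {x : ℝ} (h0 : 0 < x) (h1 : x < 1) (β : ℕ) :
    Zsum x β 0 ≠ ∞ ∧ Zsum x β 0 ≠ 0 := by
  obtain ⟨p1, p2, p3⟩ := W_pos h0 h1 β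
  constructor
  · have hs : Summable fun u : ℤ => (Wm x β + W0 x β + Wp x β) * x ^ u.natAbs := by
      apply Summable.mul_left
      apply Summable.of_nat_of_neg <;> simpa using summable_geometric_of_lt_one h0.le h1
    have := hs.tsum_ofReal_ne_top
    refine ne_top_of_le_ne_top this (ENNReal.tsum_le_tsum fun u => ?_)
    apply ENNReal.ofReal_le_ofReal
    have := wt_cases (Wm x β) (W0 x β) (Wp x β) (cst (2 * β + 2) 0) u
      (fun t => t ≤ Wm x β + W0 x β + Wp x β) (by linarith) (by linarith) (by linarith)
    simp only [zero_add, cst]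
    simp only [cst] at this
    gcongr
  · intro h
    unfold Zsum at h
    rw [ENNReal.tsum_eq_zero] at h
    have h := h 0
    rw [ENNReal.ofReal_eq_zero] at h
    have := wt_cases (Wm x β) (W0 x β) (Wp x β) (cst (2 * β + 2) 0) 0
      (fun t => 0 < t) p2 p1 p3
    have : 0 < wt (Wm x β) (W0 x β) (Wp x β) (cst (2 * β + 2) 0) 0 *
      x ^ (0 + cst (2 * β + 2) 0 0) := by positivity
    linarith

/-- Unweighted partition functions are bounded above and below uniformly in `L`. -/
theorem part_bounds {x : ℝ} (h0 : 0 < x) (h1 : x < 1) (β : ℕ)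
    (hp : 1 - 2 * x - x ^ 2 + 2 * x ^ (β + 2) - 2 * x ^ (β + 3) + 2 * x ^ (2 * β + 4) = 0) :
    ∃ c C : ℝ≥0∞, c ≠ 0 ∧ C ≠ ∞ ∧ ∀ L,
      c ≤ ∑' u : ℤ, ENNReal.ofReal x ^ (L + cst (2 * β + 2) L u) ∧
      ∑' u : ℤ, ENNReal.ofReal x ^ (L + cst (2 * β + 2) L u) ≤ C := by
  obtain ⟨p1, p2, p3⟩ := W_pos h0 h1 β
  obtain ⟨z1, z2⟩ := Zsum_zero h0 h1 β
  have hZ : ∀ L, Zsum x β L = Zsum x β 0 := by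
    intro L
    induction L with
    | zero => rfl
    | succ L ih => rw [Zsum_succ h0 h1 β L hp, ih]
  set a := min (Wm x β) (min (W0 x β) (Wp x β)) with ha
  set b := Wm x β + W0 x β + Wp x β with hb
  have ha0 : 0 < a := by rw [ha]; positivity
  have hb0 : 0 < b := by positivity
  refine ⟨(ENNReal.ofReal b)⁻¹ * Zsum x β 0, (ENNReal.ofReal a)⁻¹ * Zsum x β 0, ?_, ?_, ?_⟩
  · simp [z2]
  · apply ENNReal.mul_ne_top _ z1
    simp [ha0]
  intro L
  have k1 : Zsum x β 0 ≤ ENNReal.ofReal b *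
      ∑' u : ℤ, ENNReal.ofReal x ^ (L + cst (2 * β + 2) L u) := by
    rw [← hZ L, ← ENNReal.tsum_mul_left]
    refine ENNReal.tsum_le_tsum fun u => ?_
    rw [← ENNReal.ofReal_pow h0.le, ← ENNReal.ofReal_mul hb0.le]
    apply ENNReal.ofReal_le_ofReal
    have := wt_cases (Wm x β) (W0 x β) (Wp x β) (cst (2 * β + 2) L) u
      (fun t => t ≤ b) (by linarith) (by linarith) (by linarith)
    gcongr
  have k2 : ENNReal.ofReal a *
      ∑' u : ℤ, ENNReal.ofReal x ^ (L + cst (2 * β + 2) L u) ≤ Zsum x β 0 := by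
    rw [← hZ L, ← ENNReal.tsum_mul_left]
    refine ENNReal.tsum_le_tsum fun u => ?_
    rw [← ENNReal.ofReal_pow h0.le, ← ENNReal.ofReal_mul ha0.le]
    apply ENNReal.ofReal_le_ofReal
    have := wt_cases (Wm x β) (W0 x β) (Wp x β) (cst (2 * β + 2) L) u
      (fun t => a ≤ t) (by simp [ha]) (by simp [ha]) (by simp [ha])
    gcongr
  constructor
  · rw [mul_comm, ← div_eq_mul_inv]
    exact ENNReal.div_le_of_le_mul' k1
  · rw [mul_comm _ (Zsum x β 0), ← div_eq_mul_inv]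
    rw [ENNReal.le_div_iff_mul_le (by simp [ha0]) (by simp)]
    rwa [mul_comm]

/-! ### The polynomial -/

noncomputable def hpoly {R : Type*} [CommSemiring R] (β : ℕ) (x : R) : R :=
  x + 2 * ∑ j ∈ Finset.range β, x ^ (j + 2) + 2 * ∑ j ∈ Finset.range (β + 1), x ^ (j + (β + 3))

theorem hpoly_fac {R : Type*} [CommRing R] (β : ℕ) (x : R) :
    1 - 2 * x - x ^ 2 + 2 * x ^ (β + 2) - 2 * x ^ (β + 3) + 2 * x ^ (2 * β + 4)
      = (1 - x) * (1 - hpoly β x) := by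
  unfold hpoly
  have g1 := mul_neg_geom_sum x β
  have g2 := mul_neg_geom_sum x (β + 1)
  have s1 : ∑ j ∈ Finset.range β, x ^ (j + 2) = (∑ j ∈ Finset.range β, x ^ j) * x ^ 2 := by
    rw [Finset.sum_mul]; exact Finset.sum_congr rfl fun j _ => pow_add x j 2
  have s2 : ∑ j ∈ Finset.range (β + 1), x ^ (j + (β + 3))
      = (∑ j ∈ Finset.range (β + 1), x ^ j) * x ^ (β + 3) := by
    rw [Finset.sum_mul]; exact Finset.sum_congr rfl fun j _ => pow_add x j (β + 3)
  rw [s1, s2]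
  linear_combination 2 * x ^ 2 * g1 + 2 * x ^ (β + 3) * g2

theorem hpoly_mono (β : ℕ) {x y : ℝ} (hx : 0 ≤ x) (h : x < y) : hpoly β x < hpoly β y := by
  unfold hpoly
  have h1 : ∑ j ∈ Finset.range β, x ^ (j + 2) ≤ ∑ j ∈ Finset.range β, y ^ (j + 2) := by
    gcongr
  have h2 : ∑ j ∈ Finset.range (β + 1), x ^ (j + (β + 3))
      ≤ ∑ j ∈ Finset.range (β + 1), y ^ (j + (β + 3)) := by
    gcongr
  linarith

theorem hpoly_norm (β : ℕ) (z : ℂ) : ‖hpoly β z‖ ≤ hpoly β ‖z‖ := by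
  unfold hpoly
  refine (norm_add_le _ _).trans (add_le_add ((norm_add_le _ _).trans (add_le_add le_rfl ?_)) ?_)
  · rw [norm_mul, Complex.norm_ofNat]
    gcongr
    refine (norm_sum_le _ _).trans (le_of_eq ?_)
    simp
  · rw [norm_mul, Complex.norm_ofNat]
    gcongr
    refine (norm_sum_le _ _).trans (le_of_eq ?_)
    simp

theorem hpoly_root (β : ℕ) : ∃ r : ℝ, 0 < r ∧ r < 1 ∧ hpoly β r = 1 := by
  have hc : Continuous (fun x : ℝ => hpoly β x) := by unfold hpoly; fun_prop
  have h0 : hpoly β (0 : ℝ) = 0 := by simp [hpoly]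
  have h1 : (1 : ℝ) < hpoly β (1 : ℝ) := by
    simp only [hpoly, one_pow, Finset.sum_const, Finset.card_range, nsmul_eq_mul, mul_one]
    push_cast
    have : (0 : ℝ) ≤ β := by positivity
    linarith
  obtain ⟨r, ⟨ha, hb⟩, hr⟩ := intermediate_value_Ioo (zero_le_one' ℝ) hc.continuousOn
    (show (1 : ℝ) ∈ Set.Ioo (hpoly β (0 : ℝ)) (hpoly β (1 : ℝ)) from ⟨by rw [h0]; norm_num, h1⟩)
  exact ⟨r, ha, hb, hr⟩

/-! ### The group -/

theorem bs_rel (n : ℕ) : bsT n * bsA n * (bsT n)⁻¹ = bsA n ^ n := by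
  have h : PresentedGroup.mk (bsRels n)
      (FreeGroup.of 1 * FreeGroup.of 0 * (FreeGroup.of 1)⁻¹ * (FreeGroup.of 0 ^ n)⁻¹) = 1 :=
    PresentedGroup.one_of_mem (by simp [bsRels])
  rw [map_mul, map_mul, map_mul, map_inv, map_inv, map_pow] at h
  exact mul_inv_eq_one.1 h

theorem bs_tz (n : ℕ) (z : ℤ) : bsT n * bsA n ^ z = bsA n ^ ((n : ℤ) * z) * bsT n := by
  rw [zpow_mul, zpow_natCast, ← bs_rel, conj_zpow]; group

theorem bs_tpow (n j : ℕ) (z : ℤ) :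
    bsT n ^ j * bsA n ^ z = bsA n ^ ((n : ℤ) ^ j * z) * bsT n ^ j := by
  induction j generalizing z with
  | zero => simp
  | succ j ih =>
    rw [pow_succ, mul_assoc, bs_tz, ← mul_assoc, ih, mul_assoc, ← pow_succ]
    congr 2; ring

theorem evalWord_append (n : ℕ) (u v : List Letter) :
    evalWord n (u ++ v) = evalWord n u * evalWord n v := by
  simp [evalWord]

theorem wordLength_le (n : ℕ) (wd : List Letter) : wordLength n (evalWord n wd) ≤ wd.length :=
  Nat.sInf_le ⟨wd, rfl, rfl⟩

theorem exists_word_a (n : ℕ) (z : ℤ) :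
    ∃ wd : List Letter, evalWord n wd = bsA n ^ z ∧ wd.length = z.natAbs := by
  rcases Int.natAbs_eq z with h | h
  · refine ⟨List.replicate z.natAbs (0, true), ?_, by simp⟩
    conv_rhs => rw [h]
    generalize z.natAbs = k
    simp [evalWord, evalLetter]
  · refine ⟨List.replicate z.natAbs (0, false), ?_, by simp⟩
    conv_rhs => rw [h]
    generalize z.natAbs = k
    simp [evalWord, evalLetter]

theorem exists_word_at (n : ℕ) : ∀ (k : ℕ) (v : ℤ),
    ∃ wd : List Letter, evalWord n wd = bsA n ^ v * bsT n ^ k ∧ wd.length = k + cst n k v := by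
  intro k
  induction k with
  | zero =>
    intro v
    obtain ⟨wd, h1, h2⟩ := exists_word_a n v
    exact ⟨wd, by simp [h1], by simp [h2, cst]⟩
  | succ k ih =>
    intro v
    obtain ⟨z, hz⟩ := nxt_ex n (cst n k) v
    obtain ⟨w1, h1, h2⟩ := exists_word_a n (v - n * z)
    obtain ⟨w2, h3, h4⟩ := ih z
    refine ⟨w1 ++ ([(1, true)] ++ w2), ?_, ?_⟩
    · rw [evalWord_append, evalWord_append, h1, h3]
      have : evalWord n [(1, true)] = bsT n := by simp [evalWord, evalLetter]
      rw [this, ← mul_assoc (bsT n), bs_tz, pow_succ', mul_assoc, ← mul_assoc, ← zpow_add]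
      congr 2; ring
    · simp only [List.length_append, List.length_cons, List.length_nil, cst]
      omega

/-- Every word of length `N` has a normal form with controlled parameters. -/
theorem word_normal (n : ℕ) (wd : List Letter) :
    ∃ (m j L : ℕ) (u : ℤ), evalWord n wd = (bsT n ^ m)⁻¹ * bsA n ^ u * bsT n ^ j ∧
      m ≤ L ∧ j ≤ L ∧ L + cst n L u ≤ wd.length := by
  induction wd using List.reverseRecOn with
  | nil => exact ⟨0, 0, 0, 0, by simp [evalWord], le_rfl, le_rfl, by simp [cst]⟩
  | append_singleton wd l ih =>
    obtain ⟨m, j, L, u, h, hm, hj, hL⟩ := ih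
    have hA : ∀ s : ℤ, s.natAbs ≤ 1 → evalLetter n l = bsA n ^ s →
        ∃ (m j L : ℕ) (u : ℤ), evalWord n (wd ++ [l]) = (bsT n ^ m)⁻¹ * bsA n ^ u * bsT n ^ j ∧
        m ≤ L ∧ j ≤ L ∧ L + cst n L u ≤ (wd ++ [l]).length := by
      intro s hs hl
      refine ⟨m, j, L, u + s * (n : ℤ) ^ j, ?_, hm, hj, ?_⟩
      · rw [evalWord_append, h]
        have : evalWord n [l] = bsA n ^ s := by simp [evalWord, hl]
        rw [this, mul_assoc, bs_tpow, zpow_add, mul_comm s]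
        group
      · have := cst_add n L j hj u s hs
        simp only [List.length_append, List.length_cons, List.length_nil]
        omega
    obtain ⟨i, b⟩ := l
    rcases (show i = 0 ∨ i = 1 by omega) with rfl | rfl
    · cases b
      · exact hA (-1) (by simp) (by simp [evalLetter])
      · exact hA 1 (by simp) (by simp [evalLetter])
    · cases b
      · rcases j with _ | j
        · refine ⟨m + 1, 0, L + 1, n * u, ?_, by omega, by omega, ?_⟩
          · rw [evalWord_append, h]
            have e : evalWord n [(1, false)] = (bsT n)⁻¹ := by simp [evalWord, evalLetter]
            have e2 := bs_tz n u
            rw [e, pow_zero, mul_one, mul_one, pow_succ', mul_inv_rev, mul_assoc, mul_assoc]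
            congr 1
            rw [mul_inv_eq_iff_eq_mul, mul_assoc, ← e2]
            group
          · have := cst_mul_le n L u
            simp only [List.length_append, List.length_cons, List.length_nil]
            omega
        · refine ⟨m, j, L, u, ?_, hm, by omega, ?_⟩
          · rw [evalWord_append, h]
            have e : evalWord n [(1, false)] = (bsT n)⁻¹ := by simp [evalWord, evalLetter]
            rw [e, pow_succ]; group
          · simp only [List.length_append, List.length_cons, List.length_nil]
            omega
      · have e : evalWord n [(1, true)] = bsT n := by simp [evalWord, evalLetter]
        refine ⟨m, j + 1, L + 1, u, ?_, by omega, by omega, ?_⟩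
        · rw [evalWord_append, h, e, pow_succ]; group
        · have := cst_succ_le n L u
          simp only [List.length_append, List.length_cons, List.length_nil]
          omega

theorem exists_geo (n : ℕ) (g : BS n) :
    ∃ wd : List Letter, evalWord n wd = g ∧ wd.length = wordLength n g := by
  have hne : {N : ℕ | ∃ wd : List Letter, evalWord n wd = g ∧ wd.length = N}.Nonempty := by
    have : ∃ wd : List Letter, evalWord n wd = g := by
      obtain ⟨w, rfl⟩ := PresentedGroup.mk_surjective (bsRels n) g
      induction w using FreeGroup.induction_on with
      | C1 => exact ⟨[], by simp [evalWord]⟩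
      | of i =>
        refine ⟨[(i, true)], ?_⟩
        rcases (show i = 0 ∨ i = 1 by omega) with rfl | rfl <;>
          simp [evalWord, evalLetter, bsA, bsT] <;> rfl
      | inv_of i _ =>
        refine ⟨[(i, false)], ?_⟩
        rcases (show i = 0 ∨ i = 1 by omega) with rfl | rfl <;>
          simp [evalWord, evalLetter, bsA, bsT] <;> rfl
      | mul x y hx hy =>
        obtain ⟨a, ha⟩ := hx
        obtain ⟨b, hb⟩ := hy
        exact ⟨a ++ b, by rw [evalWord_append, ha, hb, map_mul]⟩
    obtain ⟨wd, h⟩ := this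
    exact ⟨_, wd, h, rfl⟩
  exact Nat.sInf_mem hne

theorem sphere_finite (n N : ℕ) : (bsSphere n N).Finite := by
  refine ((List.finite_length_eq Letter N).image (evalWord n)).subset ?_
  intro g hg
  obtain ⟨wd, h1, h2⟩ := exists_geo n g
  exact ⟨wd, by rw [Set.mem_ofPred_eq, h2]; exact hg, h1⟩

theorem sphere_submul (n M N : ℕ) :
    (bsSphere n (M + N)).ncard ≤ (bsSphere n M).ncard * (bsSphere n N).ncard := by
  rw [← Set.ncard_prod]
  refine (Set.ncard_le_ncard (t := (fun p : BS n × BS n => p.1 * p.2) ''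
    (bsSphere n M ×ˢ bsSphere n N)) ?_ ?_).trans (Set.ncard_image_le ?_)
  · intro g hg
    obtain ⟨wd, h1, h2⟩ := exists_geo n g
    have hg' : wordLength n g = M + N := hg
    have key : g = evalWord n (wd.take M) * evalWord n (wd.drop M) := by
      rw [← evalWord_append, List.take_append_drop, h1]
    have l1 := wordLength_le n (wd.take M)
    have l2 := wordLength_le n (wd.drop M)
    have l3 : wordLength n g ≤ wordLength n (evalWord n (wd.take M)) +
        wordLength n (evalWord n (wd.drop M)) := by
      obtain ⟨a, a1, a2⟩ := exists_geo n (evalWord n (wd.take M))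
      obtain ⟨b, b1, b2⟩ := exists_geo n (evalWord n (wd.drop M))
      rw [← a2, ← b2, key, ← a1, ← b1, ← evalWord_append, ← List.length_append]
      exact wordLength_le n _
    rw [List.length_take] at l1
    rw [List.length_drop] at l2
    refine ⟨(evalWord n (wd.take M), evalWord n (wd.drop M)), ⟨?_, ?_⟩, key.symm⟩
    · change wordLength n _ = M
      dsimp only; omega
    · change wordLength n _ = N
      dsimp only; omega
  · exact ((sphere_finite n M).prod (sphere_finite n N)).image _
  · exact (sphere_finite n M).prod (sphere_finite n N)

/-- The affine action on `ℚ`. -/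
noncomputable def affA : Equiv.Perm ℚ := Equiv.addLeft 1
noncomputable def affT (n : ℕ) (hn : (n : ℚ) ≠ 0) : Equiv.Perm ℚ := Equiv.mulLeft₀ (n : ℚ) hn

theorem affA_pow (k : ℕ) (x : ℚ) : (affA ^ k) x = k + x := by
  induction k generalizing x with
  | zero => simp
  | succ k ih => rw [pow_succ, Equiv.Perm.mul_apply, ih]; simp [affA]; ring

theorem affA_zpow (k : ℤ) (x : ℚ) : (affA ^ k) x = k + x := by
  rcases Int.eq_nat_or_neg k with ⟨m, rfl | rfl⟩
  · simp [affA_pow]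
  · rw [zpow_neg, zpow_natCast, Equiv.Perm.inv_eq_iff_eq, affA_pow]; simp

theorem affT_pow (n : ℕ) (hn : (n : ℚ) ≠ 0) (k : ℕ) (x : ℚ) :
    (affT n hn ^ k) x = (n : ℚ) ^ k * x := by
  induction k generalizing x with
  | zero => simp
  | succ k ih => rw [pow_succ, Equiv.Perm.mul_apply, ih]; simp [affT]; ring

theorem at_inj (n : ℕ) (hn : 2 ≤ n) :
    Function.Injective (fun p : ℕ × ℤ => bsA n ^ p.2 * bsT n ^ p.1) := by
  have hn0 : (n : ℚ) ≠ 0 := by positivity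
  let φ : BS n →* Equiv.Perm ℚ := PresentedGroup.toGroup (rels := bsRels n)
    (f := fun i : Fin 2 => if i = 0 then affA else affT n hn0) (by
      intro w hw
      rw [bsRels, Set.mem_singleton_iff] at hw
      subst hw
      simp only [map_mul, map_inv, map_pow, FreeGroup.lift_apply_of]
      rw [mul_inv_eq_one, mul_inv_eq_iff_eq_mul]
      ext x
      simp only [Equiv.Perm.mul_apply]
      simp [affA_pow]
      simp [affA, affT]
      ring)
  have hA : φ (bsA n) = affA := by
    simp [φ, bsA]
  have hT : φ (bsT n) = affT n hn0 := by
    simp [φ, bsT]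
  rintro ⟨k, v⟩ ⟨k', v'⟩ h
  have h1 := congrArg φ h
  simp only [map_mul, map_zpow, map_pow, hA, hT] at h1
  have h2 := congrArg (fun e : Equiv.Perm ℚ => e 0) h1
  have h3 := congrArg (fun e : Equiv.Perm ℚ => e 1) h1
  simp only [Equiv.Perm.mul_apply, affA_zpow, affT_pow, mul_zero, add_zero, mul_one] at h2 h3
  rw [h2] at h3
  have h4 : n ^ k = n ^ k' := by exact_mod_cast add_left_cancel h3
  have h5 : k = k' := Nat.pow_right_injective hn h4
  have h6 : v = v' := by exact_mod_cast h2
  rw [h5, h6]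

/-! ### Counting -/

theorem sphere_upper {x : ℝ} (h0 : 0 < x) (h1 : x < 1) (β : ℕ)
    (hp : 1 - 2 * x - x ^ 2 + 2 * x ^ (β + 2) - 2 * x ^ (β + 3) + 2 * x ^ (2 * β + 4) = 0) :
    ∃ C : ℝ, 0 < C ∧ ∀ N : ℕ, ((bsSphere (2 * β + 2) N).ncard : ℝ) * x ^ N ≤ C * (N + 1) ^ 3 := by
  obtain ⟨c, C, hc, hC, hb⟩ := part_bounds h0 h1 β hp
  refine ⟨C.toReal + 1, by positivity, fun N => ?_⟩
  set n := 2 * β + 2 with hn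
  have hch : ∀ g : bsSphere n N, ∃ p : (Fin (N + 1) × Fin (N + 1) × Fin (N + 1)) × ℤ,
      g.1 = (bsT n ^ (p.1.1 : ℕ))⁻¹ * bsA n ^ p.2 * bsT n ^ (p.1.2.1 : ℕ) ∧
      (p.1.2.2 : ℕ) + cst n p.1.2.2 p.2 ≤ N := by
    rintro ⟨g, hg⟩
    obtain ⟨wd, w1, w2⟩ := exists_geo n g
    obtain ⟨m, j, L, u, e, hm, hj, hL⟩ := word_normal n wd
    have hN : wd.length = N := w2.trans hg
    exact ⟨((⟨m, by omega⟩, ⟨j, by omega⟩, ⟨L, by omega⟩), u), by simp [← w1, e], by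
      simpa [hN] using hL⟩
  choose F hF1 hF2 using hch
  have hFi : Function.Injective F := by
    intro g g' h
    apply Subtype.ext
    rw [hF1 g, hF1 g', h]
  have hx1 : ENNReal.ofReal x ≤ 1 := by simpa using h1.le
  have key : ((bsSphere n N).ncard : ℝ≥0∞) * ENNReal.ofReal x ^ N ≤ (N + 1 : ℕ) ^ 3 * C := by
    calc ((bsSphere n N).ncard : ℝ≥0∞) * ENNReal.ofReal x ^ N
        = ∑' g : bsSphere n N, ENNReal.ofReal x ^ N := by
          have := (sphere_finite n N).fintype
          rw [tsum_fintype, Finset.sum_const, nsmul_eq_mul, Finset.card_univ,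
            ← Nat.card_eq_fintype_card, Nat.card_coe_set_eq]
      _ ≤ ∑' g : bsSphere n N,
            ENNReal.ofReal x ^ (((F g).1.2.2 : ℕ) + cst n (F g).1.2.2 (F g).2) :=
          ENNReal.tsum_le_tsum fun g => pow_le_pow_right_of_le_one' hx1 (hF2 g)
      _ ≤ ∑' p : (Fin (N + 1) × Fin (N + 1) × Fin (N + 1)) × ℤ,
            ENNReal.ofReal x ^ ((p.1.2.2 : ℕ) + cst n p.1.2.2 p.2) :=
          ENNReal.tsum_comp_le_tsum_of_injective hFi
            (fun p => ENNReal.ofReal x ^ ((p.1.2.2 : ℕ) + cst n p.1.2.2 p.2))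
      _ = ∑' q : Fin (N + 1) × Fin (N + 1) × Fin (N + 1), ∑' u : ℤ,
            ENNReal.ofReal x ^ ((q.2.2 : ℕ) + cst n q.2.2 u) := ENNReal.tsum_prod'
      _ ≤ ∑' q : Fin (N + 1) × Fin (N + 1) × Fin (N + 1), C :=
          ENNReal.tsum_le_tsum fun q => (hb q.2.2).2
      _ = (N + 1 : ℕ) ^ 3 * C := by
          rw [tsum_fintype, Finset.sum_const, nsmul_eq_mul, Finset.card_univ]
          simp only [Fintype.card_prod, Fintype.card_fin]
          push_cast; ring
  have k2 := ENNReal.toReal_mono (by finiteness) key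
  simp only [ENNReal.toReal_mul, ENNReal.toReal_pow, ENNReal.toReal_natCast,
    ENNReal.toReal_ofReal h0.le] at k2
  refine k2.trans ?_
  push_cast
  nlinarith [show (0 : ℝ) ≤ ((N : ℝ) + 1) ^ 3 by positivity]

theorem sphere_lower {x : ℝ} (h0 : 0 < x) (h1 : x < 1) (β : ℕ)
    (hp : 1 - 2 * x - x ^ 2 + 2 * x ^ (β + 2) - 2 * x ^ (β + 3) + 2 * x ^ (2 * β + 4) = 0)
    (N : ℕ) (hN : 1 ≤ N) : 1 ≤ ((bsSphere (2 * β + 2) N).ncard : ℝ) * x ^ N := by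
  obtain ⟨c, C, hc, hC, hb⟩ := part_bounds h0 h1 β hp
  set n := 2 * β + 2 with hn
  have hx1 : ENNReal.ofReal x ≤ 1 := by simpa using h1.le
  have top1 : ∑' g : BS n, ENNReal.ofReal x ^ wordLength n g = ∞ := by
    rw [eq_top_iff]
    calc ∞ = ∑' _ : ℕ, c := (ENNReal.tsum_const_eq_top_of_ne_zero hc).symm
      _ ≤ ∑' k : ℕ, ∑' u : ℤ, ENNReal.ofReal x ^ (k + cst n k u) :=
          ENNReal.tsum_le_tsum fun k => (hb k).1
      _ = ∑' p : ℕ × ℤ, ENNReal.ofReal x ^ (p.1 + cst n p.1 p.2) := by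
          rw [ENNReal.tsum_prod']
      _ ≤ ∑' p : ℕ × ℤ, ENNReal.ofReal x ^ wordLength n (bsA n ^ p.2 * bsT n ^ p.1) := by
          refine ENNReal.tsum_le_tsum fun p => pow_le_pow_right_of_le_one' hx1 ?_
          obtain ⟨wd, w1, w2⟩ := exists_word_at n p.1 p.2
          rw [← w1, ← w2]
          exact wordLength_le n wd
      _ ≤ _ := ENNReal.tsum_comp_le_tsum_of_injective (at_inj n (by omega))
            (fun g => ENNReal.ofReal x ^ wordLength n g)
  have top2 : ∑' k : ℕ, ENNReal.ofReal (((bsSphere n k).ncard : ℝ) * x ^ k) = ∞ := by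
    rw [← top1, ← (Equiv.sigmaFiberEquiv (wordLength n)).tsum_eq, ENNReal.tsum_sigma']
    refine tsum_congr fun k => ?_
    have : Fintype {g : BS n // wordLength n g = k} := (sphere_finite n k).fintype
    rw [tsum_fintype]
    have : ∀ b : {g : BS n // wordLength n g = k}, ENNReal.ofReal x ^
        wordLength n ((Equiv.sigmaFiberEquiv (wordLength n)) ⟨k, b⟩) = ENNReal.ofReal x ^ k := by
      rintro ⟨b, hb⟩
      simp [Equiv.sigmaFiberEquiv, hb]
    simp only [this]
    rw [Finset.sum_const, nsmul_eq_mul, Finset.card_univ, ← Nat.card_eq_fintype_card,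
      ENNReal.ofReal_mul (by positivity), ENNReal.ofReal_pow h0.le, ENNReal.ofReal_natCast]
    rfl
  by_contra! hlt
  set a : ℕ → ℝ := fun k => ((bsSphere n k).ncard : ℝ) * x ^ k with ha
  have ha0 : ∀ k, 0 ≤ a k := fun k => by positivity
  have hstep : ∀ k, a (N + k) ≤ a N * a k := by
    intro k
    have : ((bsSphere n (N + k)).ncard : ℝ) ≤ (bsSphere n N).ncard * (bsSphere n k).ncard := by
      exact_mod_cast sphere_submul n N k
    calc a (N + k) ≤ ((bsSphere n N).ncard * (bsSphere n k).ncard) * x ^ (N + k) := by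
          simp only [ha]; gcongr
      _ = a N * a k := by simp only [ha]; ring
  have hlt' : a N < 1 := hlt
  have hbd : ∀ K, ∑ k ∈ Finset.range K, a k ≤ (∑ k ∈ Finset.range N, a k) / (1 - a N) := by
    intro K
    rw [le_div_iff₀ (by linarith)]
    have e1 : ∑ k ∈ Finset.range K, a k ≤ ∑ k ∈ Finset.range (N + K), a k :=
      Finset.sum_le_sum_of_subset_of_nonneg (Finset.range_subset_range.2 (by omega))
        fun i _ _ => ha0 i
    have e2 : ∑ k ∈ Finset.range K, a (N + k) ≤ a N * ∑ k ∈ Finset.range K, a k := by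
      rw [Finset.mul_sum]; exact Finset.sum_le_sum fun k _ => hstep k
    rw [Finset.sum_range_add] at e1
    nlinarith
  have hs : Summable a := summable_of_sum_range_le ha0 hbd
  exact hs.tsum_ofReal_ne_top top2

theorem limit_aux {x : ℝ} (h0 : 0 < x) (s : ℕ → ℝ) (C : ℝ) (hC : 0 < C)
    (hl : ∀ N, 1 ≤ N → 1 ≤ s N * x ^ N) (hu : ∀ N : ℕ, s N * x ^ N ≤ C * (N + 1) ^ 3) :
    Tendsto (fun N : ℕ => s N ^ (1 / (N : ℝ))) atTop (𝓝 (1 / x)) := by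
  have hT : Tendsto (fun N : ℕ => (s N * x ^ N) ^ (1 / (N : ℝ))) atTop (𝓝 1) := by
    have u1 : Tendsto (fun N : ℕ => (C * 8) ^ (1 / (N : ℝ)) * ((N : ℝ) ^ (1 / (N : ℝ))) ^ 3)
        atTop (𝓝 1) := by
      have a1 : Tendsto (fun N : ℕ => (C * 8) ^ (1 / (N : ℝ))) atTop (𝓝 1) := by
        have := (Real.continuousAt_const_rpow (a := C * 8) (b := 0) (by positivity)).tendsto.comp
          tendsto_one_div_atTop_nhds_zero_nat
        simpa [Function.comp_def] using this
      have a2 : Tendsto (fun N : ℕ => (N : ℝ) ^ (1 / (N : ℝ))) atTop (𝓝 1) :=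
        tendsto_rpow_div.comp tendsto_natCast_atTop_atTop
      simpa using a1.mul (a2.pow 3)
    refine tendsto_of_tendsto_of_tendsto_of_le_of_le' tendsto_const_nhds u1 ?_ ?_
    · filter_upwards [eventually_ge_atTop 1] with N hN
      exact Real.one_le_rpow (hl N hN) (by positivity)
    · filter_upwards [eventually_ge_atTop 1] with N hN
      have hN' : (1 : ℝ) ≤ N := by exact_mod_cast hN
      have e : s N * x ^ N ≤ C * 8 * (N : ℝ) ^ 3 := by
        refine (hu N).trans ?_
        have : ((N : ℝ) + 1) ^ 3 ≤ (2 * N) ^ 3 := by gcongr; linarith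
        nlinarith
      calc (s N * x ^ N) ^ (1 / (N : ℝ)) ≤ (C * 8 * (N : ℝ) ^ 3) ^ (1 / (N : ℝ)) :=
            Real.rpow_le_rpow (zero_le_one.trans (hl N hN)) e (by positivity)
        _ = _ := by
            rw [Real.mul_rpow (by positivity) (by positivity), ← Real.rpow_natCast,
              ← Real.rpow_natCast, ← Real.rpow_mul (by positivity),
              ← Real.rpow_mul (by positivity), mul_comm (1 / (N : ℝ))]
  have := hT.div_const x
  refine this.congr' ?_
  filter_upwards [eventually_ge_atTop 1] with N hN
  have hs : 0 ≤ s N := by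
    have := hl N hN
    by_contra! h
    have : s N * x ^ N < 0 := mul_neg_of_neg_of_pos h (by positivity)
    linarith
  rw [Real.mul_rpow hs (by positivity), one_div, Real.pow_rpow_inv_natCast h0.le (by omega)]
  field_simp

/-- The growth rate of `BS(1,n)` for even `n ≥ 2`: the polynomial
`1 - 2x - x² + 2x^{α+1} - 2x^{α+2} + 2x^{2α+2}` (with `α = n/2`) has a unique real root `r`
in `(0,1)`, which is its root of smallest magnitude, and `lim |S_n(N)|^{1/N} = 1/r`. -/
theorem growth_rate_BS_even (n α : ℕ) (hn : 2 ≤ n) (heven : Even n) (hα : α = n / 2) :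
    ∃ r : ℝ, (0 < r ∧ r < 1) ∧
      (1 - 2 * r - r ^ 2 + 2 * r ^ (α + 1) - 2 * r ^ (α + 2) + 2 * r ^ (2 * α + 2)) = 0 ∧
      (∀ r' : ℝ, 0 < r' → r' < 1 →
        (1 - 2 * r' - r' ^ 2 + 2 * r' ^ (α + 1) - 2 * r' ^ (α + 2) + 2 * r' ^ (2 * α + 2)) = 0 →
        r' = r) ∧
      (∀ z : ℂ,
        (1 - 2 * z - z ^ 2 + 2 * z ^ (α + 1) - 2 * z ^ (α + 2) + 2 * z ^ (2 * α + 2)) = 0 →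
        r ≤ ‖z‖) ∧
      Tendsto (fun N : ℕ => ((bsSphere n N).ncard : ℝ) ^ (1 / (N : ℝ)))
        atTop (𝓝 (1 / r)) := by
  obtain ⟨β, rfl⟩ : ∃ β, n = 2 * β + 2 := by
    obtain ⟨k, hk⟩ := heven
    exact ⟨k - 1, by omega⟩
  obtain rfl : α = β + 1 := by omega
  obtain ⟨r, h0, h1, hr⟩ := hpoly_root β
  have hp : 1 - 2 * r - r ^ 2 + 2 * r ^ (β + 2) - 2 * r ^ (β + 3) + 2 * r ^ (2 * β + 4) = 0 := by
    rw [hpoly_fac, hr]; ring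
  refine ⟨r, ⟨h0, h1⟩, hp, ?_, ?_, ?_⟩
  · intro r' h0' h1' hp'
    have e : (1 - r') * (1 - hpoly β r') = 0 := by rw [← hpoly_fac]; exact hp'
    have e' : hpoly β r' = 1 := by
      rcases mul_eq_zero.1 e with h | h <;> linarith
    rcases lt_trichotomy r' r with h | h | h
    · have := hpoly_mono β h0'.le h; linarith
    · exact h
    · have := hpoly_mono β h0.le h; linarith
  · intro z hz
    have e : (1 - z) * (1 - hpoly β z) = 0 := by rw [← hpoly_fac]; exact hz
    rcases mul_eq_zero.1 e with h | h
    · rw [← sub_eq_zero.1 h]; simpa using h1.le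
    · by_contra! hlt
      have h2 := hpoly_mono β (norm_nonneg z) hlt
      have h3 := hpoly_norm β z
      rw [← sub_eq_zero.1 h, norm_one] at h3
      linarith
  · obtain ⟨C, hC, hu⟩ := sphere_upper h0 h1 β hp
    exact limit_aux h0 _ C hC (sphere_lower h0 h1 β hp) hu
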